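/- Case (iii) of the proof of Theorem 1: In the GCQC setup, for levels 1 ≤ i < j ≤ m, any u ∈ S_{A_i}^⊥ ∖ S_{A_i}, and any v ∈ S_{A_j}, the sum φ_i(u) + φ_j(v) has symplectic weight at least d_i D_i; i.e., multiplying a nontrivial level-i logical operator by a stabilizer element coming from a higher level j > i does not reduce its weight below d_i D_i. -/

import Mathlib

open Finset

/-- Pauli operators (up to phase) on `n` qubits, as symplectic vectors. -/
abbrev Pauli (n : ℕ) := Fin n → (ZMod 2) × (ZMod 2)

/-- The outer space `W = (𝔽₂^r × 𝔽₂^r)^N`. -/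
abbrev Outer (r N : ℕ) := Fin N → (Fin r → ZMod 2) × (Fin r → ZMod 2)

/-- `N` blocks of `n` qubits each. -/
abbrev PauliB (n N : ℕ) := Fin N → Pauli n

/-- Elementary symplectic form on one qubit. -/
def B0 : LinearMap.BilinForm (ZMod 2) ((ZMod 2) × (ZMod 2)) :=
  LinearMap.mk₂ (ZMod 2) (fun u v => u.1 * v.2 + v.1 * u.2)
    (fun a b v => by simp; ring)
    (fun c a v => by simp; ring)
    (fun a b v => by simp; ring)
    (fun c a v => by simp; ring)

/-- Sum of a bilinear form over `N` coordinates. -/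
def sumForm {M : Type*} [AddCommGroup M] [Module (ZMod 2) M] (N : ℕ)
    (B : LinearMap.BilinForm (ZMod 2) M) :
    LinearMap.BilinForm (ZMod 2) (Fin N → M) :=
  LinearMap.mk₂ (ZMod 2) (fun u v => ∑ j, B (u j) (v j))
    (fun a b v => by simp [Finset.sum_add_distrib])
    (fun c a v => by simp [Finset.mul_sum])
    (fun a b v => by simp [Finset.sum_add_distrib])
    (fun c a v => by simp [Finset.mul_sum])

/-- Symplectic form on `r`-qubit blocks written as pairs of binary `r`-vectors. -/
def pairForm (r : ℕ) : LinearMap.BilinForm (ZMod 2) ((Fin r → ZMod 2) × (Fin r → ZMod 2)) :=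
  LinearMap.mk₂ (ZMod 2) (fun u v => ∑ ℓ, (u.1 ℓ * v.2 ℓ + v.1 ℓ * u.2 ℓ))
    (fun a b v => by rw [← Finset.sum_add_distrib]; refine Finset.sum_congr rfl fun ℓ _ => by simp; ring)
    (fun c a v => by rw [smul_eq_mul, Finset.mul_sum]; refine Finset.sum_congr rfl fun ℓ _ => by simp; ring)
    (fun a b v => by rw [← Finset.sum_add_distrib]; refine Finset.sum_congr rfl fun ℓ _ => by simp; ring)
    (fun c a v => by rw [smul_eq_mul, Finset.mul_sum]; refine Finset.sum_congr rfl fun ℓ _ => by simp; ring)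

/-- Symplectic form on `Pauli n`. -/
def symplF (n : ℕ) : LinearMap.BilinForm (ZMod 2) (Pauli n) := sumForm n B0

/-- Symplectic form on `N` blocks of `n` qubits. -/
def symplFB (n N : ℕ) : LinearMap.BilinForm (ZMod 2) (PauliB n N) := sumForm N (symplF n)

/-- Symplectic form on the outer space `W_i`. -/
def symplFO (r N : ℕ) : LinearMap.BilinForm (ZMod 2) (Outer r N) := sumForm N (pairForm r)

/-- Orthogonal complement of a subspace w.r.t. a bilinear form. -/
def perp {M : Type*} [AddCommGroup M] [Module (ZMod 2) M]
    (B : LinearMap.BilinForm (ZMod 2) M) (S : Submodule (ZMod 2) M) :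
    Submodule (ZMod 2) M where
  carrier := {v | ∀ s ∈ S, B s v = 0}
  add_mem' := fun hu hv s hs => by
    rw [map_add, hu s hs, hv s hs, add_zero]
  zero_mem' := fun s hs => by simp
  smul_mem' := fun c v hv s hs => by
    rw [map_smul, hv s hs, smul_zero]

/-- Generic weight: number of nonzero coordinates. -/
def wgt {N : ℕ} {M : Type*} [Zero M] [DecidableEq M] (v : Fin N → M) : ℕ :=
  (Finset.univ.filter fun j => v j ≠ 0).card

/-- Symplectic weight on `N` blocks of `n` qubits: number of nonzero qubit positions. -/
def swtB {n N : ℕ} (v : PauliB n N) : ℕ := ∑ j, wgt (v j)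

/-- Stabilizer of the subcode `B_i`: `S` together with the logical `z`'s of index `< kk`. -/
def Sstab (n : ℕ) (S : Submodule (ZMod 2) (Pauli n)) (z : ℕ → Pauli n) (kk : ℕ) :
    Submodule (ZMod 2) (Pauli n) :=
  S ⊔ Submodule.span (ZMod 2) (z '' Set.Iio kk)

/-- Span of the logical operators `x_t, z_t` with `a ≤ t < b` (0-based indexing). -/
def Lspan (n : ℕ) (x z : ℕ → Pauli n) (a b : ℕ) : Submodule (ZMod 2) (Pauli n) :=
  Submodule.span (ZMod 2) ((x '' Set.Ico a b) ∪ (z '' Set.Ico a b))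

/-- The block-wise inner stabilizer `S_I`. -/
def SI (n N : ℕ) (S : Submodule (ZMod 2) (Pauli n)) : Submodule (ZMod 2) (PauliB n N) :=
  Submodule.pi (Set.univ : Set (Fin N)) (fun _ => S)

/-- The replacement map `φ` with offset `off`, sending the `ℓ`-th binary coordinates of each
block to the logical operators `x (off+ℓ)`, `z (off+ℓ)` of the inner code. -/
def phi (n N : ℕ) (x z : ℕ → Pauli n) (off r : ℕ) :
    Outer r N →ₗ[ZMod 2] PauliB n N where
  toFun w := fun j =>
    (∑ ℓ : Fin r, (w j).1 ℓ • x (off + ℓ)) + (∑ ℓ : Fin r, (w j).2 ℓ • z (off + ℓ))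
  map_add' := fun a b => by
    funext j
    simp [add_smul, Finset.sum_add_distrib]
    abel
  map_smul' := fun c a => by
    funext j
    simp [mul_smul, Finset.smul_sum, smul_add]

theorem symplF_comm {n : ℕ} (u v : Pauli n) : symplF n u v = symplF n v u := by
  simp only [symplF, sumForm, B0, LinearMap.mk₂_apply]
  exact Finset.sum_congr rfl fun _ _ => add_comm _ _

theorem phi_apply {n N : ℕ} (x z : ℕ → Pauli n) (off r : ℕ) (w : Outer r N) (b : Fin N) :
    phi n N x z off r w b =
      (∑ ℓ : Fin r, (w b).1 ℓ • x (off + ℓ)) + (∑ ℓ : Fin r, (w b).2 ℓ • z (off + ℓ)) := rfl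

/-- An operator orthogonal to all the logical operators `x (off + ℓ)`, `z (off + ℓ)` is orthogonal
to every block of a vector in the image of the replacement map. -/
theorem symplF_phi_eq_zero {n N : ℕ} {x z : ℕ → Pauli n} {off r : ℕ} {y : Pauli n}
    (hx : ∀ ℓ < r, symplF n y (x (off + ℓ)) = 0) (hz : ∀ ℓ < r, symplF n y (z (off + ℓ)) = 0)
    (w : Outer r N) (b : Fin N) : symplF n y (phi n N x z off r w b) = 0 := by
  simp [phi_apply, hx, hz]

theorem symplF_x_phi {n N κ : ℕ} {x z : ℕ → Pauli n}
    (hxx : ∀ s < κ, ∀ t < κ, symplF n (x s) (x t) = 0)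
    (hxz : ∀ s < κ, ∀ t < κ, symplF n (x s) (z t) = if s = t then 1 else 0)
    {off r : ℕ} (hr : off + r ≤ κ) (w : Outer r N) (b : Fin N) (ℓ : Fin r) :
    symplF n (x (off + ℓ)) (phi n N x z off r w b) = (w b).2 ℓ := by
  have h (a : Fin r) : off + (a : ℕ) < κ := by omega
  simp [phi_apply, hxx _ (h ℓ) _ (h _), hxz _ (h ℓ) _ (h _), Fin.val_inj]

theorem symplF_z_phi {n N κ : ℕ} {x z : ℕ → Pauli n}
    (hzz : ∀ s < κ, ∀ t < κ, symplF n (z s) (z t) = 0)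
    (hxz : ∀ s < κ, ∀ t < κ, symplF n (x s) (z t) = if s = t then 1 else 0)
    {off r : ℕ} (hr : off + r ≤ κ) (w : Outer r N) (b : Fin N) (ℓ : Fin r) :
    symplF n (z (off + ℓ)) (phi n N x z off r w b) = (w b).1 ℓ := by
  have h (a : Fin r) : off + (a : ℕ) < κ := by omega
  simp [phi_apply, hzz _ (h ℓ) _ (h _), symplF_comm (z _) (x _), hxz _ (h _) _ (h ℓ), Fin.val_inj]

/-- An operator orthogonal to `S` and to the logical operators `z s` with `s < kk` is orthogonal to
the stabilizer of the subcode. -/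
theorem mem_perp_Sstab {n : ℕ} {S : Submodule (ZMod 2) (Pauli n)} {z : ℕ → Pauli n} {kk : ℕ}
    {y : Pauli n} (hS : y ∈ perp (symplF n) S) (hz : ∀ s < kk, symplF n (z s) y = 0) :
    y ∈ perp (symplF n) (Sstab n S z kk) := by
  suffices h : Sstab n S z kk ≤ LinearMap.ker ((symplF n).flip y) from fun s hs => h hs
  refine sup_le (fun s hs => hS s hs) (Submodule.span_le.2 ?_)
  rintro _ ⟨s, hs, rfl⟩
  exact hz s hs

/-- If every block on which `u` is nonzero has weight at least `a` in `w`, then the symplectic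
weight of `w` is at least `a` times the block weight of `u`. -/
theorem mul_wgt_le_swtB {n N a : ℕ} {M : Type*} [Zero M] [DecidableEq M] {u : Fin N → M}
    {w : PauliB n N} (h : ∀ b, u b ≠ 0 → a ≤ wgt (w b)) : a * wgt u ≤ swtB w := by
  rw [mul_comm, wgt, ← smul_eq_mul]
  exact (Finset.card_nsmul_le_sum _ _ a fun b hb => h b (Finset.mem_filter.1 hb).2).trans
    (Finset.sum_le_sum_of_subset (Finset.filter_subset _ _))

/-- Case (iii) of the proof of Theorem 1: adding a stabilizer element coming from a
higher level `j > i` to a nontrivial level-`i` logical operator keeps the weight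
`≥ d_i D_i`. -/
theorem gcqc_case_iii
    (n N m : ℕ) (hm : 1 ≤ m)
    (k : ℕ → ℕ) (hk : ∀ i, 1 ≤ i → i ≤ m → k (i + 1) < k i) (hklast : k (m + 1) = 0)
    (hkn : k 1 ≤ n)
    (S : Submodule (ZMod 2) (Pauli n))
    (hSorth : S ≤ perp (symplF n) S)
    (hSdim : Module.finrank (ZMod 2) S = n - k 1)
    (x z : ℕ → Pauli n)
    (hxS : ∀ t < k 1, x t ∈ perp (symplF n) S)
    (hzS : ∀ t < k 1, z t ∈ perp (symplF n) S)
    (hxx : ∀ s < k 1, ∀ t < k 1, symplF n (x s) (x t) = 0)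
    (hzz : ∀ s < k 1, ∀ t < k 1, symplF n (z s) (z t) = 0)
    (hxz : ∀ s < k 1, ∀ t < k 1, symplF n (x s) (z t) = if s = t then 1 else 0)
    (hdual : perp (symplF n) S = S ⊔ Lspan n x z 0 (k 1))
    (hdisj : Disjoint S (Lspan n x z 0 (k 1)))
    (d : ℕ → ℕ)
    (hd : ∀ i, 1 ≤ i → i ≤ m + 1 → ∀ v ∈ perp (symplF n) (Sstab n S z (k 1 - k i)),
      v ∉ Sstab n S z (k 1 - k i) → d i ≤ wgt v)
    (K D : ℕ → ℕ) (hKN : ∀ i, 1 ≤ i → i ≤ m → K i ≤ N)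
    (SA : ∀ i : ℕ, Submodule (ZMod 2) (Outer (k i - k (i + 1)) N))
    (hSAorth : ∀ i, 1 ≤ i → i ≤ m → SA i ≤ perp (symplFO (k i - k (i + 1)) N) (SA i))
    (hSAdim : ∀ i, 1 ≤ i → i ≤ m →
      Module.finrank (ZMod 2) (SA i) = (k i - k (i + 1)) * (N - K i))
    (hSAdist : ∀ i, 1 ≤ i → i ≤ m → ∀ w ∈ perp (symplFO (k i - k (i + 1)) N) (SA i),
      w ∉ SA i → D i ≤ wgt w)
    (i j : ℕ) (h1i : 1 ≤ i) (hij : i < j) (hjm : j ≤ m)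
    (u : Outer (k i - k (i + 1)) N)
    (hu : u ∈ perp (symplFO (k i - k (i + 1)) N) (SA i)) (hu' : u ∉ SA i)
    (v : Outer (k j - k (j + 1)) N) (hv : v ∈ SA j) :
    d i * D i ≤ swtB (phi n N x z (k 1 - k i) (k i - k (i + 1)) u
      + phi n N x z (k 1 - k j) (k j - k (j + 1)) v) := by
  have hanti {a b : ℕ} (ha : 1 ≤ a) (hab : a ≤ b) (hb : b ≤ m + 1) : k b ≤ k a := by
    induction b, hab using Nat.le_induction with
    | base => exact le_rfl
    | succ c hc ih => exact (hk c (by omega) (by omega)).le.trans (ih (by omega))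
  have hi1 : k i ≤ k 1 := hanti le_rfl h1i (by omega)
  have hii : k (i + 1) ≤ k i := hanti h1i (by omega) (by omega)
  have hji : k j ≤ k (i + 1) := hanti (by omega) hij (by omega)
  have hjj : k (j + 1) ≤ k j := hanti (by omega) (by omega) (by omega)
  have hxz' : ∀ s < k 1, ∀ t < k 1, s ≠ t → symplF n (x s) (z t) = 0 :=
    fun s hs t ht hst => by rw [hxz s hs t ht, if_neg hst]
  have hzx : ∀ s < k 1, ∀ t < k 1, s ≠ t → symplF n (z s) (x t) = 0 :=
    fun s hs t ht hst => by rw [symplF_comm, hxz' t ht s hs hst.symm]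
  refine (Nat.mul_le_mul_left _ (hSAdist i h1i (by omega) u hu hu')).trans
    (mul_wgt_le_swtB fun b hb => hd i h1i (by omega) _ (mem_perp_Sstab ?_ ?_) fun hmem => hb ?_)
  · intro s hs
    rw [Pi.add_apply, map_add,
      symplF_phi_eq_zero (fun ℓ _ => hxS _ (by omega) s hs) (fun ℓ _ => hzS _ (by omega) s hs) u b,
      symplF_phi_eq_zero (fun ℓ _ => hxS _ (by omega) s hs) (fun ℓ _ => hzS _ (by omega) s hs) v b,
      add_zero]
  · intro s hs
    rw [Pi.add_apply, map_add,
      symplF_phi_eq_zero (fun ℓ _ => hzx _ (by omega) _ (by omega) (by omega))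
        (fun ℓ _ => hzz _ (by omega) _ (by omega)) u b,
      symplF_phi_eq_zero (fun ℓ _ => hzx _ (by omega) _ (by omega) (by omega))
        (fun ℓ _ => hzz _ (by omega) _ (by omega)) v b,
      add_zero]
  · have hx (ℓ : Fin (k i - k (i + 1))) : x (k 1 - k i + ℓ) ∈
        perp (symplF n) (Sstab n S z (k 1 - k i)) :=
      mem_perp_Sstab (hxS _ (by omega)) fun s hs => hzx _ (by omega) _ (by omega) (by omega)
    have hz (ℓ : Fin (k i - k (i + 1))) : z (k 1 - k i + ℓ) ∈
        perp (symplF n) (Sstab n S z (k 1 - k i)) :=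
      mem_perp_Sstab (hzS _ (by omega)) fun s hs => hzz _ (by omega) _ (by omega)
    ext ℓ
    · have h := hz ℓ _ hmem
      rwa [symplF_comm, Pi.add_apply, map_add, symplF_z_phi hzz hxz (by omega) u b ℓ,
        symplF_phi_eq_zero (fun t _ => hzx _ (by omega) _ (by omega) (by omega))
          (fun t _ => hzz _ (by omega) _ (by omega)) v b, add_zero] at h
    · have h := hx ℓ _ hmem
      rwa [symplF_comm, Pi.add_apply, map_add, symplF_x_phi hxx hxz (by omega) u b ℓ,
        symplF_phi_eq_zero (fun t _ => hxx _ (by omega) _ (by omega))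
          (fun t _ => hxz' _ (by omega) _ (by omega) (by omega)) v b, add_zero] at h
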